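/- Let G be a rooted graph with root u of type 2. Then G has no rooted immersion of W_4. -/

import Mathlib

open scoped Classical

noncomputable section

namespace PaperW4

/-- A finite loopless undirected multigraph on ambient vertex type `V`:
a finite vertex set together with a multiset of (non-loop) edges supported on it. -/
structure MG (V : Type) where
  verts : Finset V
  edges : Multiset (Sym2 V)
  edge_support : ∀ e ∈ edges, ∀ v ∈ e, v ∈ verts
  loopless : ∀ e ∈ edges, ¬ e.IsDiag

variable {V : Type} {W : Type}

/-- `δ_G(X)`: the edges of `G` with exactly one endpoint in `X`. -/
def cutEdges (G : MG V) (X : Finset V) : Multiset (Sym2 V) :=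
  G.edges.filter fun e => ∃ u v, e = s(u, v) ∧ u ∈ X ∧ v ∉ X

/-- `d_G(X) = |δ_G(X)|`. -/
def dcut (G : MG V) (X : Finset V) : ℕ := (cutEdges G X).card

/-- The degree of a vertex: the number of edges incident with it. -/
def deg (G : MG V) (v : V) : ℕ := (G.edges.filter fun e => v ∈ e).card

/-- `e_G(u,v)`: the number of edges joining `u` and `v`. -/
def emult (G : MG V) (u v : V) : ℕ := G.edges.count s(u, v)

/-- `G` is `k`-edge-connected: every edge-cut `δ(X)` with `∅ ≠ X ⊊ V(G)` has size `≥ k`. -/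
def EdgeConn (G : MG V) (k : ℕ) : Prop :=
  ∀ X : Finset V, X ⊆ G.verts → X.Nonempty → X ≠ G.verts → k ≤ dcut G X

/-- `G` is internally `k`-edge-connected: every edge-cut with at least two vertices
on each side has size `≥ k`. -/
def InternallyEdgeConn (G : MG V) (k : ℕ) : Prop :=
  ∀ X : Finset V, X ⊆ G.verts → 2 ≤ X.card → 2 ≤ (G.verts \ X).card → k ≤ dcut G X

/-- Every vertex has degree three. -/
def Cubic (G : MG V) : Prop := ∀ v ∈ G.verts, deg G v = 3

/-- The multiset of edges traversed by a walk, given as its list of vertices. -/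
def walkEdges (l : List V) : Multiset (Sym2 V) :=
  (↑((l.zip l.tail).map fun p => s(p.1, p.2)) : Multiset (Sym2 V))

/-- `l` is (the vertex sequence of) a walk from `u` to `v`. -/
def IsWalk (l : List V) (u v : V) : Prop :=
  l.head? = some u ∧ l.getLast? = some v

/-- `G` is connected: any two of its vertices are joined by a trail in `G`. -/
def Connected (G : MG V) : Prop :=
  ∀ u ∈ G.verts, ∀ v ∈ G.verts,
    ∃ l : List V, IsWalk l u v ∧ walkEdges l ≤ G.edges ∧ ∀ w ∈ l, w ∈ G.verts

/-- An immersion of the loopless multigraph with vertex type `W` and edge multiset `H`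
into `G`, with terminal map `φ`: `φ` is injective, and to each edge `uv` of `H` is
assigned a walk in `G` from `φ u` to `φ v`, these walks being globally edge-disjoint. -/
def ImmersionVia (G : MG V) (H : Multiset (Sym2 W)) (φ : W → V) : Prop :=
  Function.Injective φ ∧ (∀ w : W, φ w ∈ G.verts) ∧
  ∃ P : Multiset (Sym2 W × List V),
    P.map Prod.fst = H ∧
    (∀ p ∈ P, ∃ u v : W, p.1 = s(u, v) ∧ IsWalk p.2 (φ u) (φ v)) ∧
    (P.map fun p => walkEdges p.2).sum ≤ G.edges

/-- The edges of the wheel `W₄`: vertex `0` is the center, `1,2,3,4` the rim cycle. -/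
def w4Edges : Multiset (Sym2 (Fin 5)) :=
  {s(0, 1), s(0, 2), s(0, 3), s(0, 4), s(1, 2), s(2, 3), s(3, 4), s(4, 1)}

/-- `G` has an immersion of `W₄`. -/
def HasW4Immersion (G : MG V) : Prop :=
  ∃ φ : Fin 5 → V, ImmersionVia G w4Edges φ

/-- `G` (rooted at `x`) has a rooted immersion of `W₄`: one in which the
center of `W₄` corresponds to `x`. -/
def HasRootedW4Immersion (G : MG V) (x : V) : Prop :=
  ∃ φ : Fin 5 → V, φ 0 = x ∧ ImmersionVia G w4Edges φ

/-- The edges of `D_m`: roots are `0, 1`; vertices `2, 3` play the role of `y₀, y₁`;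
there are `m - 2` parallel edges between the two roots. -/
def dmEdges (m : ℕ) : Multiset (Sym2 (Fin 4)) :=
  Multiset.replicate (m - 2) s(0, 1) + {s(0, 2), s(0, 3), s(1, 2), s(1, 3), s(2, 3)}

/-- `G` with roots `x0, x1` has a rooted immersion of `D_m`. -/
def HasRootedDmImmersion (G : MG V) (m : ℕ) (x0 x1 : V) : Prop :=
  ∃ φ : Fin 4 → V, φ 0 = x0 ∧ φ 1 = x1 ∧ ImmersionVia G (dmEdges m) φ

/-- The edges of `K₄`. -/
def k4Edges : Multiset (Sym2 (Fin 4)) :=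
  {s(0, 1), s(0, 2), s(0, 3), s(1, 2), s(1, 3), s(2, 3)}

/-- A nested chain of vertex sets `C 0 ⊂ C 1 ⊂ ⋯`, each obtained from the previous
by adding one vertex, all cuts having size exactly `k`. -/
def SegChain (G : MG V) (n : ℕ) (C : Fin (n + 1) → Finset V) (k : ℕ) : Prop :=
  (∀ i, C i ⊆ G.verts) ∧
  (∀ i : Fin n, C i.castSucc ⊆ C i.succ ∧ (C i.succ \ C i.castSucc).card = 1) ∧
  (∀ i, dcut G (C i) = k)

/-- `G` has a segmentation of width `k` relative to `(X, Y)`. -/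
def HasSegmentation (G : MG V) (X Y : Finset V) (k : ℕ) : Prop :=
  ∃ (n : ℕ) (C : Fin (n + 1) → Finset V),
    SegChain G n C k ∧ C 0 = X ∧ G.verts \ C (Fin.last n) = Y

/-- `λ_s(G) ≥ m`: every edge-cut separating `x0` from `x1` has size `≥ m`. -/
def LamSGe (G : MG V) (x0 x1 : V) (m : ℕ) : Prop :=
  ∀ X : Finset V, X ⊆ G.verts → x0 ∈ X → x1 ∉ X → m ≤ dcut G X

/-- `λ_n(G) ≥ m`: every edge-cut not separating `x0` from `x1` has size `≥ m`. -/
def LamNGe (G : MG V) (x0 x1 : V) (m : ℕ) : Prop :=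
  ∀ X : Finset V, X ⊆ G.verts → X.Nonempty → X ≠ G.verts →
    (x0 ∈ X ↔ x1 ∈ X) → m ≤ dcut G X

/-- `λ_n^i(G) ≥ m`: every internal edge-cut not separating `x0` from `x1` has size `≥ m`. -/
def LamNiGe (G : MG V) (x0 x1 : V) (m : ℕ) : Prop :=
  ∀ X : Finset V, X ⊆ G.verts → 2 ≤ X.card → 2 ≤ (G.verts \ X).card →
    (x0 ∈ X ↔ x1 ∈ X) → m ≤ dcut G X

/-- The subgraph of `G` induced on `S`. -/
def induce (G : MG V) (S : Finset V) : MG V where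
  verts := G.verts ∩ S
  edges := G.edges.filter fun e => ∀ v ∈ e, v ∈ S
  edge_support := by
    intro e he v hv
    rw [Multiset.mem_filter] at he
    exact Finset.mem_inter.mpr ⟨G.edge_support e he.1 v hv, he.2 v hv⟩
  loopless := fun e he => G.loopless e (Multiset.mem_of_mem_filter he)

/-- `G` with the vertices of `S` (and all incident edges) deleted. -/
def deleteVerts (G : MG V) (S : Finset V) : MG V := induce G (G.verts \ S)

/-- `C` is (the vertex set of) a connected component of `G`. -/
def IsComponent (G : MG V) (C : Finset V) : Prop :=
  C ⊆ G.verts ∧ C.Nonempty ∧ Connected (induce G C) ∧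
  ∀ e ∈ G.edges, (∃ v ∈ e, v ∈ C) → ∀ v ∈ e, v ∈ C

/-- `G` has type `A_m` with respect to roots `x0, x1`. -/
def TypeA (G : MG V) (m : ℕ) (x0 x1 : V) : Prop :=
  ∃ X0 X1 : Finset V, x0 ∈ X0 ∧ x1 ∈ X1 ∧ X0.card ≤ 2 ∧ X1.card ≤ 2 ∧
    HasSegmentation G X0 X1 m

/-- The edges of the lobe of `G` (with roots `x0, x1`) corresponding to the
component `C` of `G ∖ {x0, x1}`: edges inside `C ∪ {x0, x1}` other than `x0x1`-edges. -/
def lobeEdges (G : MG V) (C : Finset V) (x0 x1 : V) : Multiset (Sym2 V) :=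
  G.edges.filter fun e => (∀ v ∈ e, v ∈ insert x0 (insert x1 C)) ∧ e ≠ s(x0, x1)

/-- `G` has type `B_m` with respect to roots `x0, x1`. -/
def TypeB (G : MG V) (m : ℕ) (x0 x1 : V) : Prop :=
  ∃ (k : ℕ) (C : Fin k → Finset V) (nL : Fin k → ℕ),
    Function.Injective C ∧
    (∀ D : Finset V, IsComponent (deleteVerts G {x0, x1}) D ↔ ∃ i, C i = D) ∧
    (∀ i : Fin k, 2 ≤ nL i ∧
      ∃ l : List V, l.Nodup ∧ IsWalk l x0 x1 ∧
        l.toFinset = insert x0 (insert x1 (C i)) ∧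
        (2 ≤ (C i).card → nL i = 2) ∧
        lobeEdges G (C i) x0 x1 = nL i • walkEdges l) ∧
    emult G x0 x1 + ∑ i, nL i = m + 1

/-- The edge multiset of a cycle of length `n` on the vertices `f 0, f 1, …`. -/
def cycleEdges (n : ℕ) (f : Fin n → V) : Multiset (Sym2 V) :=
  (Finset.univ.val : Multiset (Fin n)).map fun i =>
    s(f i, f ⟨(i.val + 1) % n, Nat.mod_lt _ i.pos⟩)

/-- `G` is a doubled cycle of length `n`. -/
def IsDoubledCycleLen (G : MG V) (n : ℕ) : Prop :=
  ∃ f : Fin n → V, Function.Injective f ∧ Finset.univ.image f = G.verts ∧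
    G.edges = 2 • cycleEdges n f

/-- `G` is a doubled cycle. -/
def IsDoubledCycle (G : MG V) : Prop := ∃ n, 3 ≤ n ∧ IsDoubledCycleLen G n

/-- The map collapsing all of `Y` to the vertex `y0` and fixing everything else. -/
def collapseFun (Y : Finset V) (y0 : V) : V → V := fun v => if v ∈ Y then y0 else v

/-- The image multigraph of `G` under a vertex map `f` (identification of vertices),
with any created loops deleted. -/
def mapGraph (f : V → V) (G : MG V) : MG V where
  verts := G.verts.image f
  edges := (G.edges.map (Sym2.map f)).filter fun e => ¬e.IsDiag
  edge_support := by
    intro e he v hv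
    rw [Multiset.mem_filter] at he
    obtain ⟨he, -⟩ := he
    rw [Multiset.mem_map] at he
    obtain ⟨e', he', rfl⟩ := he
    rw [Sym2.mem_map] at hv
    obtain ⟨u, hu, rfl⟩ := hv
    exact Finset.mem_image_of_mem f (G.edge_support e' he' u hu)
  loopless := by
    intro e he
    rw [Multiset.mem_filter] at he
    exact he.2

/-- `G[X]` is a chain of sausages of order `k` in `G`: identifying `V(G) ∖ X` to a
single vertex yields a doubled cycle of length `k + 1`. -/
def ChainOfSausages (G : MG V) (X : Finset V) (k : ℕ) : Prop :=
  X ⊆ G.verts ∧ X.card = k ∧ 2 ≤ k ∧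
  ∃ y0 ∈ G.verts \ X,
    IsDoubledCycleLen (mapGraph (collapseFun (G.verts \ X) y0) G) (k + 1)

/-- `G` is sausage reduced: it has no chain of sausages of order at least `3`. -/
def SausageReduced (G : MG V) : Prop :=
  ¬ ∃ (X : Finset V) (k : ℕ), 3 ≤ k ∧ ChainOfSausages G X k

/-- One sausage shortening step of a rooted graph: two adjacent vertices of a chain of
sausages of order at least three are identified, carrying the root along. -/
def RootedShortStep (p q : MG V × V) : Prop :=
  ∃ (X : Finset V) (k : ℕ) (a b : V),
    3 ≤ k ∧ ChainOfSausages p.1 X k ∧ a ∈ X ∧ b ∈ X ∧ a ≠ b ∧ s(a, b) ∈ p.1.edges ∧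
    q.1 = mapGraph (fun v => if v = b then a else v) p.1 ∧
    q.2 = (if p.2 = b then a else p.2)

/-- Deleting a single copy of the edge `e` from `G`. -/
def deleteEdge (G : MG V) (e : Sym2 V) : MG V where
  verts := G.verts
  edges := G.edges.erase e
  edge_support := fun e' he' => G.edge_support e' (Multiset.mem_of_mem_erase he')
  loopless := fun e' he' => G.loopless e' (Multiset.mem_of_mem_erase he')

/-- `G` has a tree-decomposition of width at most `k`. -/
def HasTreeDecomp (G : MG V) (k : ℕ) : Prop :=
  ∃ (ι : Type) (T : SimpleGraph ι) (B : ι → Finset V),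
    T.IsTree ∧
    (∀ t, B t ⊆ G.verts) ∧
    (∀ v ∈ G.verts, ∃ t, v ∈ B t) ∧
    (∀ e ∈ G.edges, ∃ t, ∀ v ∈ e, v ∈ B t) ∧
    (∀ v ∈ G.verts, (SimpleGraph.induce {t | v ∈ B t} T).Connected) ∧
    ∀ t, (B t).card ≤ k + 1

/-- The tree-width of `G`. -/
def treewidth (G : MG V) : ℕ := sInf { k | HasTreeDecomp G k }

/-- One subdivision step: an edge `uv` is replaced by a path `u - w - v`
through a new vertex `w`. -/
def SubdivStep (G H : MG V) : Prop :=
  ∃ u v w : V, s(u, v) ∈ G.edges ∧ w ∉ G.verts ∧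
    H.verts = insert w G.verts ∧
    H.edges = (G.edges.erase s(u, v)) + {s(u, w), s(w, v)}

/-- `H` is a subdivision of `G`. -/
def IsSubdivision (G H : MG V) : Prop := Relation.ReflTransGen SubdivStep G H

/-- `G`, rooted at `u`, has type 2 (for the rooted `W₄` theorem). -/
def TypeTwo (G : MG V) (u : V) : Prop :=
  ∃ W0 : Finset V, W0 ⊆ G.verts ∧ u ∉ W0 ∧ 1 ≤ W0.card ∧ W0.card ≤ 2 ∧
    ∃ w0 ∈ W0,
      ∃ n : ℕ, 3 ≤ n ∧
        ∃ f : Fin n → V,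
          Function.Injective f ∧
          Finset.univ.image f = (mapGraph (collapseFun W0 w0) G).verts ∧
          (∃ i, f i = u) ∧ (∃ j, f j = w0) ∧
          ((s(u, w0) ∉ cycleEdges n f ∧
              (mapGraph (collapseFun W0 w0) G).edges =
                2 • cycleEdges n f + {s(u, w0)}) ∨
           (∃ v : V, s(u, v) ∈ cycleEdges n f ∧ s(v, w0) ∈ cycleEdges n f ∧
              (mapGraph (collapseFun W0 w0) G).edges =
                2 • cycleEdges n f + {s(u, v), s(v, w0)}) ∨
           (s(u, w0) ∈ cycleEdges n f ∧
              (mapGraph (collapseFun W0 w0) G).edges =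
                2 • cycleEdges n f + {s(u, w0)}))

/-- The number of bits of `v` equal to one. -/
def weight {m : ℕ} (v : BitVec m) : ℕ := ∑ k : Fin m, (v.getLsb k).toNat

/-- The endpoints of the edges of `W₄`: spokes first, then the rim. -/
def wheelEnds : Fin 8 → Fin 5 × Fin 5 :=
  ![(0, 1), (0, 2), (0, 3), (0, 4), (1, 2), (2, 3), (3, 4), (4, 1)]

/-- The indicator of the edges of `W₄` leaving the set formed by the center
and the rim vertices `k + 1` with `r.getLsb k`. -/
def wheelCut (r : BitVec 4) : BitVec 8 := (r ^^^ r.rotateRight 1) ++ ~~~r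

theorem two_lt_weight_of_weight_eq_one : ∀ c : BitVec 8, weight c ≤ 2 →
    ∀ r : BitVec 4, weight r = 1 → ¬ weight (c ^^^ wheelCut r) ≤ 2 := by
  decide +kernel

theorem two_lt_weight_of_weight_eq_three : ∀ c : BitVec 8, weight (c ^^^ wheelCut 0) ≤ 2 →
    ∀ r : BitVec 4, weight r = 3 → ¬ weight (c ^^^ wheelCut r) ≤ 2 := by
  decide +kernel

theorem no_wheel_routing_chord : ∀ h : BitVec 8, weight h ≤ 1 →
    ∀ c : BitVec 8, weight c ≤ 2 → weight (c ^^^ h ^^^ wheelCut 0) ≤ 2 →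
    ∀ a : BitVec 4, weight a ≤ 2 → weight (c ^^^ h ^^^ wheelCut a) ≤ 2 →
    ∀ x : BitVec 4, x &&& a = x → weight x ≤ 1 → weight a ≤ weight x + 1 →
      weight (c ^^^ h ^^^ wheelCut x) ≤ 2 →
    ∀ d : BitVec 4, a &&& d = a → weight d ≤ weight a + 2 → 2 ≤ weight d →
      weight (c ^^^ wheelCut d) ≤ 2 →
    ∀ y : BitVec 4, d &&& y = d → 3 ≤ weight y → weight y ≤ weight d + 1 →
      ¬ weight (c ^^^ wheelCut y) ≤ 2 := by
  decide +kernel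

theorem no_wheel_routing_path : ∀ c : BitVec 8, weight c ≤ 2 →
    weight (c ^^^ wheelCut 0) ≤ 3 →
    ∀ a : BitVec 4, weight a ≤ 1 → weight (c ^^^ wheelCut a) ≤ 3 →
    ∀ d : BitVec 4, a &&& d = a → weight d ≤ weight a + 2 → 2 ≤ weight d →
      weight (c ^^^ wheelCut d) ≤ 2 →
    ∀ y : BitVec 4, d &&& y = d → 3 ≤ weight y → weight y ≤ weight d + 1 →
      ¬ weight (c ^^^ wheelCut y) ≤ 2 := by
  decide +kernel

theorem getLsb_wheelCut (r : BitVec 4) (R : Fin 5 → Bool) (h0 : R 0 = true)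
    (h : ∀ k : Fin 4, r.getLsb k = R k.succ) (k : Fin 8) :
    (wheelCut r).getLsb k = (R (wheelEnds k).1 ^^ R (wheelEnds k).2) := by
  have key : ∀ r : BitVec 4, ∀ k : Fin 8, (wheelCut r).getLsb k =
      ((Fin.cons true r.getLsb : Fin 5 → Bool) (wheelEnds k).1 ^^
        (Fin.cons true r.getLsb : Fin 5 → Bool) (wheelEnds k).2) := by
    decide +kernel
  have hR : (Fin.cons true r.getLsb : Fin 5 → Bool) = R := by
    funext j
    refine Fin.cases ?_ (fun k => ?_) j
    · simp [h0]
    · simpa using h k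
  rw [key, hR]

theorem w4Edges_eq_map_wheelEnds :
    w4Edges = (Finset.univ.val : Multiset (Fin 8)).map
      fun k => s((wheelEnds k).1, (wheelEnds k).2) := rfl

theorem exists_eq_map_of_map_fst_eq {ι α β : Type*} [Inhabited β] (g : ι → α) (s : Finset ι) :
    ∀ P : Multiset (α × β), P.map Prod.fst = s.val.map g →
      ∃ w : ι → β, P = s.val.map fun k => (g k, w k) := by
  induction s using Finset.induction_on with
  | empty =>
    intro P hP
    exact ⟨fun _ => default, by simpa using hP⟩
  | insert a s ha ih =>
    intro P hP
    rw [Finset.insert_val_of_notMem ha, Multiset.map_cons, ← Multiset.map_eq_cons] at hP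
    obtain ⟨x, hx, hxa, hP⟩ := hP
    obtain ⟨w, hw⟩ := ih _ hP
    refine ⟨Function.update w a x.2, ?_⟩
    rw [Finset.insert_val_of_notMem ha, Multiset.map_cons, ← Multiset.cons_erase hx, hw]
    congr 1
    · simp [← hxa]
    · refine Multiset.map_congr rfl fun k hk => ?_
      rw [Function.update_of_ne]
      rintro rfl
      exact ha hk

/-- The two ends of `e` receive different values under `χ`. -/
def Separates {α : Type*} (χ : α → Bool) (e : Sym2 α) : Prop := ¬ (e.map χ).IsDiag

@[simp] theorem separates_mk {α : Type*} (χ : α → Bool) (a b : α) :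
    Separates χ s(a, b) ↔ χ a ≠ χ b := by
  simp [Separates]

theorem walkEdges_cons_cons (x y : V) (t : List V) :
    walkEdges (x :: y :: t) = s(x, y) ::ₘ walkEdges (y :: t) := by
  simp [walkEdges]

theorem walkEdges_map (g : V → W) (l : List V) :
    walkEdges (l.map g) = (walkEdges l).map (Sym2.map g) := by
  match l with
  | [] => simp [walkEdges]
  | [x] => simp [walkEdges]
  | x :: y :: t =>
    have := walkEdges_map g (y :: t)
    rw [List.map_cons] at this
    rw [List.map_cons, List.map_cons, walkEdges_cons_cons, walkEdges_cons_cons, this]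
    simp

theorem IsWalk.map {l : List V} {a b : V} (h : IsWalk l a b) (g : V → W) :
    IsWalk (l.map g) (g a) (g b) := by
  obtain ⟨h1, h2⟩ := h
  exact ⟨by simp [List.head?_map, h1], by simp [List.getLast?_map, h2]⟩

theorem odd_countP_separates (χ : V → Bool) {b : V} :
    ∀ (l : List V) (a : V), IsWalk l a b →
      (Odd ((walkEdges l).countP (Separates χ)) ↔ χ a ≠ χ b)
  | [], a, h => by simp [IsWalk] at h
  | [x], a, h => by
    obtain ⟨rfl, rfl⟩ : x = a ∧ x = b := by simpa [IsWalk] using h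
    simp [walkEdges]
  | x :: y :: t, a, h => by
    obtain ⟨rfl, hb⟩ : x = a ∧ (y :: t).getLast? = some b := by
      simpa [IsWalk, List.getLast?_cons_cons] using h
    have ih := odd_countP_separates χ (y :: t) y ⟨rfl, hb⟩
    rw [walkEdges_cons_cons, Multiset.countP_cons]
    split_ifs with hs
    · rw [Nat.odd_add_one, ih]
      rw [separates_mk] at hs
      revert hs
      cases χ x <;> cases χ y <;> cases χ b <;> simp
    · rw [add_zero, ih]
      rw [separates_mk, not_not] at hs
      rw [hs]

theorem ImmersionVia.exists_walks {G : MG V} {φ : Fin 5 → V} (h : ImmersionVia G w4Edges φ) :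
    ∃ w : Fin 8 → List V,
      (∀ k, IsWalk (w k) (φ (wheelEnds k).1) (φ (wheelEnds k).2) ∨
        IsWalk (w k) (φ (wheelEnds k).2) (φ (wheelEnds k).1)) ∧
      ∑ k, walkEdges (w k) ≤ G.edges := by
  obtain ⟨-, -, P, hP, hwalk, hle⟩ := h
  rw [w4Edges_eq_map_wheelEnds] at hP
  obtain ⟨w, hw⟩ := exists_eq_map_of_map_fst_eq _ _ P hP
  refine ⟨w, fun k => ?_, ?_⟩
  · obtain ⟨a, b, hab, hk⟩ := hwalk (s((wheelEnds k).1, (wheelEnds k).2), w k) (by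
      rw [hw]; exact Multiset.mem_map_of_mem _ (Finset.mem_univ k))
    rcases Sym2.eq_iff.mp hab with ⟨h1, h2⟩ | ⟨h1, h2⟩
    · left; rw [h1, h2]; exact hk
    · right; rw [h1, h2]; exact hk
  · rw [hw, Multiset.map_map] at hle
    exact hle

theorem weight_le_sum {m : ℕ} (v : BitVec m) (x : Fin m → ℕ)
    (h : ∀ k, v.getLsb k = decide (Odd (x k))) : weight v ≤ ∑ k, x k := by
  refine Finset.sum_le_sum fun k _ => ?_
  rw [h]
  by_cases hk : Odd (x k)
  · simpa [hk] using Nat.succ_le_of_lt hk.pos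
  · simp [hk]

/-- The set of rim vertices `k + 1` of `W₄` placed at a position at most `i`. -/
def below (p : Fin 5 → ℕ) (i : ℕ) : BitVec 4 := BitVec.ofFnLE fun k => decide (p k.succ ≤ i)

theorem getLsb_below (p : Fin 5 → ℕ) (i : ℕ) (k : Fin 4) :
    (below p i).getLsb k = decide (p k.succ ≤ i) := by
  rw [below, BitVec.getLsb_ofFnLE]

theorem weight_below (p : Fin 5 → ℕ) (i : ℕ) :
    weight (below p i) = (Finset.univ.filter fun k : Fin 4 => p k.succ ≤ i).card := by
  rw [weight, Finset.card_filter]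
  refine Finset.sum_congr rfl fun k _ => ?_
  rw [getLsb_below]
  by_cases h : p k.succ ≤ i <;> simp [h]

theorem weight_below_succ (p : Fin 5 → ℕ) (i : ℕ) :
    weight (below p (i + 1)) =
      weight (below p i) + (Finset.univ.filter fun k : Fin 4 => p k.succ = i + 1).card := by
  rw [weight_below, weight_below, ← Finset.card_union_of_disjoint]
  · congr 1
    ext k
    simp
    omega
  · rw [Finset.disjoint_filter]
    intro k _ h
    omega

theorem weight_below_mono (p : Fin 5 → ℕ) : Monotone fun i => weight (below p i) :=
  monotone_nat_of_le_succ fun i => by rw [weight_below_succ]; omega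

theorem below_and_below (p : Fin 5 → ℕ) {i j : ℕ} (h : i ≤ j) :
    below p i &&& below p j = below p i := by
  apply BitVec.eq_of_getLsbD_eq
  intro k hk
  have h1 := getLsb_below p i ⟨k, hk⟩
  have h2 := getLsb_below p j ⟨k, hk⟩
  rw [BitVec.getLsb_eq_getElem] at h1 h2
  rw [BitVec.getLsbD_eq_getElem hk, BitVec.getLsbD_eq_getElem hk, BitVec.getElem_and]
  simp only [Fin.getElem_fin] at h1 h2
  rw [h1, h2]
  simpa using fun h3 => le_trans h3 h

theorem below_zero (p : Fin 5 → ℕ) (h : ∀ k : Fin 4, 1 ≤ p k.succ) : below p 0 = 0 := by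
  have h0 : weight (below p 0) = 0 := by
    rw [weight_below, Finset.card_eq_zero, Finset.filter_eq_empty_iff]
    intro k _
    have := h k
    omega
  have : ∀ v : BitVec 4, weight v = 0 → v = 0 := by decide +kernel
  exact this _ h0

theorem exists_eq_of_step_le_one (N : ℕ → ℕ) {a b m : ℕ} (hab : a ≤ b) (ha : N a ≤ m)
    (hb : m ≤ N b) (hstep : ∀ i, a ≤ i → i < b → N (i + 1) ≤ N i + 1) :
    ∃ i, a ≤ i ∧ i ≤ b ∧ N i = m := by
  induction b, hab using Nat.le_induction with
  | base => exact ⟨a, le_rfl, le_rfl, le_antisymm ha hb⟩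
  | succ b hab ih =>
    by_cases h : m ≤ N b
    · obtain ⟨i, h1, h2, h3⟩ := ih h fun i hi hib => hstep i hi (by omega)
      exact ⟨i, h1, by omega, h3⟩
    · have := hstep b hab (by omega)
      exact ⟨b + 1, by omega, le_rfl, by omega⟩

/-- The rim vertices of `W₄` occupy positions `1, …, n - 1`, with no coincidences except
that two of them may be placed at `q`. -/
structure IsPlacement (n q : ℕ) (p : Fin 5 → ℕ) : Prop where
  center : p 0 = 0
  pos : ∀ k : Fin 4, 1 ≤ p k.succ
  lt : ∀ k : Fin 4, p k.succ < n
  card_le_one : ∀ j, j ≠ q → (Finset.univ.filter fun k : Fin 4 => p k.succ = j).card ≤ 1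
  card_le_two : (Finset.univ.filter fun k : Fin 4 => p k.succ = q).card ≤ 2

namespace IsPlacement

variable {n q : ℕ} {p : Fin 5 → ℕ}

theorem weight_zero (hp : IsPlacement n q p) : weight (below p 0) = 0 := by
  rw [below_zero p hp.pos]
  decide

theorem weight_last (hp : IsPlacement n q p) : weight (below p (n - 1)) = 4 := by
  rw [weight_below, Finset.filter_true_of_mem]
  · simp
  · intro k _
    have := hp.lt k
    omega

theorem weight_succ_le (hp : IsPlacement n q p) {i : ℕ} (hi : i + 1 ≠ q) :
    weight (below p (i + 1)) ≤ weight (below p i) + 1 := by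
  rw [weight_below_succ]
  have := hp.card_le_one (i + 1) hi
  omega

theorem weight_le_add_two (hp : IsPlacement n q p) (hq : 1 ≤ q) :
    weight (below p q) ≤ weight (below p (q - 1)) + 2 := by
  obtain ⟨i, rfl⟩ : ∃ i, q = i + 1 := ⟨q - 1, by omega⟩
  rw [weight_below_succ, Nat.add_sub_cancel]
  have := hp.card_le_two
  omega

theorem exists_above (hp : IsPlacement n q p) (hqn : q + 2 ≤ n) (c : BitVec 8)
    (hc : weight c ≤ 2)
    (hload : ∀ i, q ≤ i → i + 1 < n → weight (c ^^^ wheelCut (below p i)) ≤ 2) :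
    2 ≤ weight (below p q) ∧
      ∃ i, q ≤ i ∧ i + 1 < n ∧ 3 ≤ weight (below p i) ∧
        weight (below p i) ≤ weight (below p q) + 1 := by
  have hstep : ∀ i, q ≤ i → i < n - 2 → weight (below p (i + 1)) ≤ weight (below p i) + 1 :=
    fun i hi _ => hp.weight_succ_le (by omega)
  have hlast : 3 ≤ weight (below p (n - 2)) := by
    have h1 := hp.weight_last
    have h2 := hp.weight_succ_le (i := n - 2) (by omega)
    rw [show n - 2 + 1 = n - 1 by omega] at h2
    omega
  have h2 : 2 ≤ weight (below p q) := by
    by_contra! h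
    obtain ⟨i, h1, h2, h3⟩ := exists_eq_of_step_le_one (fun i => weight (below p i)) (m := 1)
      (show q ≤ n - 2 by omega) (by omega) (by omega) hstep
    exact two_lt_weight_of_weight_eq_one c hc _ h3 (hload i h1 (by omega))
  refine ⟨h2, ?_⟩
  by_cases h3 : 3 ≤ weight (below p q)
  · exact ⟨q, le_rfl, by omega, h3, by omega⟩
  · obtain ⟨i, h1, h2, h3⟩ := exists_eq_of_step_le_one (fun i => weight (below p i)) (m := 3)
      (show q ≤ n - 2 by omega) (by omega) (by omega) hstep
    exact ⟨i, h1, by omega, by omega, by omega⟩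

theorem false_of_chord (hp : IsPlacement n q p) (hq : 1 ≤ q) (hqn : q + 2 ≤ n)
    (c h : BitVec 8) (hc : weight c ≤ 2) (hh : weight h ≤ 1)
    (hload : ∀ i, i + 1 < n →
      weight (c ^^^ (if i < q then h else 0) ^^^ wheelCut (below p i)) ≤ 2) : False := by
  have hlow : ∀ i, i < q → weight (c ^^^ h ^^^ wheelCut (below p i)) ≤ 2 := fun i hi => by
    simpa [hi] using hload i (by omega)
  have hhigh : ∀ i, q ≤ i → i + 1 < n → weight (c ^^^ wheelCut (below p i)) ≤ 2 :=
    fun i hi hin => by simpa [hi.not_gt] using hload i hin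
  have h0 := hlow 0 (by omega)
  rw [below_zero p hp.pos] at h0
  obtain ⟨hD, y, hqy, hyn, hy3, hyle⟩ := hp.exists_above hqn c hc hhigh
  have hstep : ∀ i, 0 ≤ i → i < q - 1 → weight (below p (i + 1)) ≤ weight (below p i) + 1 :=
    fun i _ hi => hp.weight_succ_le (by omega)
  have hz := hp.weight_zero
  have hA : weight (below p (q - 1)) ≤ 2 := by
    by_contra! h3
    obtain ⟨i, h1, h2, h3⟩ := exists_eq_of_step_le_one (fun i => weight (below p i)) (m := 3)
      (Nat.zero_le (q - 1)) (by omega) (by omega) hstep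
    exact two_lt_weight_of_weight_eq_three _ h0 _ h3 (hlow i (by omega))
  obtain ⟨x, hxq, hx1, hx2⟩ : ∃ x, x ≤ q - 1 ∧ weight (below p x) ≤ 1 ∧
      weight (below p (q - 1)) ≤ weight (below p x) + 1 := by
    by_cases h1 : weight (below p (q - 1)) ≤ 1
    · exact ⟨q - 1, le_rfl, h1, by omega⟩
    · obtain ⟨i, h1, h2, h3⟩ := exists_eq_of_step_le_one (fun i => weight (below p i)) (m := 1)
        (Nat.zero_le (q - 1)) (by omega) (by omega) hstep
      exact ⟨i, h2, by omega, by omega⟩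
  exact no_wheel_routing_chord h hh c hc h0 _ hA (hlow _ (by omega)) _
    (below_and_below p hxq) hx1 hx2 (hlow _ (by omega)) _
    (below_and_below p (Nat.sub_le q 1)) (hp.weight_le_add_two hq) hD
    (hhigh q le_rfl (by omega)) _ (below_and_below p hqy) hy3 hyle (hhigh y hqy hyn)

theorem false_of_path (hp : IsPlacement n q p) (hn : 3 ≤ n) (hq : 1 ≤ q) (hq2 : q ≤ 2)
    (c : BitVec 8) (hc : weight c ≤ 2)
    (hlow : ∀ i, i + 1 < n → weight (c ^^^ wheelCut (below p i)) ≤ 3)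
    (hhigh : ∀ i, q ≤ i → i + 1 < n → weight (c ^^^ wheelCut (below p i)) ≤ 2) : False := by
  have h0 := hlow 0 (by omega)
  rw [below_zero p hp.pos] at h0
  have hz := hp.weight_zero
  have hA : weight (below p (q - 1)) ≤ 1 := by
    obtain rfl | rfl : q = 1 ∨ q = 2 := by omega
    · simp [hz]
    · have := hp.weight_succ_le (i := 0) (by omega)
      simp only [Nat.reduceSub, zero_add] at this ⊢
      omega
  have hAD := hp.weight_le_add_two hq
  have hqn : q + 2 ≤ n := by
    by_contra! hlt
    have h1 := hp.weight_last
    have h2 := weight_below_mono p (show n - 1 ≤ q by omega)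
    simp only at h2
    omega
  obtain ⟨hD, y, hqy, hyn, hy3, hyle⟩ := hp.exists_above hqn c hc hhigh
  exact no_wheel_routing_path c hc h0 _ hA (hlow _ (by omega)) _
    (below_and_below p (Nat.sub_le q 1)) hAD hD
    (hhigh q le_rfl (by omega)) _ (below_and_below p hqy) hy3 hyle (hhigh y hqy hyn)

end IsPlacement

theorem countP_separates_cycle {n r : ℕ} (hn : 3 ≤ n) (hr1 : r ≠ 1)
    (hr2 : r ≠ n - 1) {i : ℕ} (hi : i + 1 < n) (M : Multiset (Sym2 ℕ)) :
    (∀ e ∈ M, ¬ e.IsDiag →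
      (∃ j, j + 1 < n ∧ e = s(j, j + 1)) ∨ e = s(0, n - 1) ∨ e = s(0, r)) →
    M.countP (Separates fun x => decide (x ≤ i)) =
      M.count s(i, i + 1) + M.count s(0, n - 1) + if i < r then M.count s(0, r) else 0 := by
  induction M using Multiset.induction_on with
  | empty => simp
  | cons e M ih =>
    intro hM
    have ih := ih fun e he => hM e (Multiset.mem_cons_of_mem he)
    rw [Multiset.countP_cons, Multiset.count_cons, Multiset.count_cons, Multiset.count_cons, ih]
    have he := hM e (Multiset.mem_cons_self e M)
    have key : (if Separates (fun x => decide (x ≤ i)) e then 1 else 0) =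
        (if s(i, i + 1) = e then 1 else 0) + (if s(0, n - 1) = e then 1 else 0) +
          if i < r then (if s(0, r) = e then 1 else 0) else 0 := by
      by_cases hd : e.IsDiag
      · induction e using Sym2.ind with
        | _ x y =>
        obtain rfl : x = y := by simpa using hd
        have h1 : ¬ s(i, i + 1) = s(x, x) := by simp; omega
        have h2 : ¬ s(0, n - 1) = s(x, x) := by simp; omega
        have h3 : i < r → ¬ s(0, r) = s(x, x) := by simp; omega
        rw [if_neg h1, if_neg h2]
        by_cases h : i < r
        · simp [h, h3 h]
        · simp [h]
      · rcases he hd with ⟨j, hj, rfl⟩ | rfl | rfl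
        · have h2 : ¬ s(0, n - 1) = s(j, j + 1) := by simp; omega
          have h3 : ¬ s(0, r) = s(j, j + 1) := by simp; omega
          have h1 : s(i, i + 1) = s(j, j + 1) ↔ i = j := by simp; omega
          have h4 : Separates (fun x => decide (x ≤ i)) s(j, j + 1) ↔ i = j := by
            simp; omega
          simp only [h1, h2, h3, h4]
          simp
        · have h1 : ¬ s(i, i + 1) = s(0, n - 1) := by simp; omega
          have h3 : ¬ s(0, r) = s(0, n - 1) := by simp; omega
          have h4 : Separates (fun x => decide (x ≤ i)) s(0, n - 1) := by
            simp; omega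
          simp [h1, h3, h4]
        · have h1 : ¬ s(i, i + 1) = s(0, r) := by simp; omega
          have h2 : ¬ s(0, n - 1) = s(0, r) := by simp; omega
          have h4 : Separates (fun x => decide (x ≤ i)) s(0, r) ↔ i < r := by
            simp
          simp only [h1, h2, h4]
          simp
    rw [key]
    split_ifs <;> omega

/-- A packing of walks realising `W₄` in a graph on `0, …, n - 1` whose edges are those of the
cycle and copies of the chord `0r` is described, modulo two, by its uses `c` of the edge
`(n - 1)0` and `h` of the chord. -/
theorem exists_loads {n r : ℕ} (hn : 3 ≤ n) (hr1 : r ≠ 1) (hr2 : r ≠ n - 1)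
    (p : Fin 5 → ℕ) (p0 : p 0 = 0) (M : Fin 8 → Multiset (Sym2 ℕ))
    (hodd : ∀ k (χ : ℕ → Bool), Odd ((M k).countP (Separates χ)) ↔
      χ (p (wheelEnds k).1) ≠ χ (p (wheelEnds k).2))
    (E : Multiset (Sym2 ℕ)) (hE : (∑ k, M k).filter (fun e => ¬ e.IsDiag) ≤ E)
    (hmem : ∀ e ∈ E, (∃ j, j + 1 < n ∧ e = s(j, j + 1)) ∨ e = s(0, n - 1) ∨ e = s(0, r)) :
    ∃ c h : BitVec 8, weight c ≤ E.count s(0, n - 1) ∧ (0 < r → weight h ≤ E.count s(0, r)) ∧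
      ∀ i, i + 1 < n →
        weight (c ^^^ (if i < r then h else 0) ^^^ wheelCut (below p i)) ≤
          E.count s(i, i + 1) := by
  have hcount : ∀ e : Sym2 ℕ, ¬ e.IsDiag → ∑ k, (M k).count e ≤ E.count e := by
    intro e he
    calc ∑ k, (M k).count e = (∑ k, M k).count e := (Multiset.count_sum' ..).symm
      _ = ((∑ k, M k).filter fun e => ¬ e.IsDiag).count e :=
        (Multiset.count_filter_of_pos (p := fun e : Sym2 ℕ => ¬ e.IsDiag) he).symm
      _ ≤ E.count e := Multiset.count_le_of_le _ hE
  have hM : ∀ k, ∀ e ∈ M k, ¬ e.IsDiag →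
      (∃ j, j + 1 < n ∧ e = s(j, j + 1)) ∨ e = s(0, n - 1) ∨ e = s(0, r) := by
    intro k e he hd
    refine hmem e (Multiset.mem_of_le hE (Multiset.mem_filter.mpr ⟨?_, hd⟩))
    exact Multiset.mem_sum.mpr ⟨k, Finset.mem_univ k, he⟩
  refine ⟨BitVec.ofFnLE fun k => decide (Odd ((M k).count s(0, n - 1))),
    BitVec.ofFnLE fun k => decide (Odd ((M k).count s(0, r))), ?_, fun h => ?_, fun i hi => ?_⟩
  · refine (weight_le_sum _ (fun k => (M k).count s(0, n - 1)) fun k => ?_).trans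
      (hcount _ (by simp; omega))
    rw [BitVec.getLsb_ofFnLE]
  · refine (weight_le_sum _ (fun k => (M k).count s(0, r)) fun k => ?_).trans
      (hcount _ (by simp; omega))
    rw [BitVec.getLsb_ofFnLE]
  · refine (weight_le_sum _ (fun k => (M k).count s(i, i + 1)) fun k => ?_).trans
      (hcount _ (by simp))
    have h1 := countP_separates_cycle hn hr1 hr2 hi (M k) (hM k)
    have h2 := hodd k fun x => decide (x ≤ i)
    have h3 := getLsb_wheelCut (below p i) (fun j => decide (p j ≤ i)) (by simp [p0])
      (getLsb_below p i) k
    have hxor : ∀ a b : BitVec 8, (a ^^^ b).getLsb k = (a.getLsb k ^^ b.getLsb k) := by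
      intro a b
      simp
    rw [hxor, hxor, h3, BitVec.getLsb_ofFnLE]
    rw [h1] at h2
    generalize decide (p (wheelEnds k).1 ≤ i) = A at *
    generalize decide (p (wheelEnds k).2 ≤ i) = B at *
    have hif : (if i < r then BitVec.ofFnLE fun k => decide (Odd ((M k).count s(0, r)))
        else (0 : BitVec 8)).getLsb k =
        decide (Odd (if i < r then (M k).count s(0, r) else 0)) := by
      split_ifs
      · rw [BitVec.getLsb_ofFnLE]
      · simp
    rw [hif]
    generalize (if i < r then (M k).count s(0, r) else 0) = z at *
    rw [Nat.odd_add, Nat.odd_add, ← Nat.not_odd_iff_even, ← Nat.not_odd_iff_even] at h2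
    by_cases hx : Odd ((M k).count s(i, i + 1)) <;>
    by_cases hy : Odd ((M k).count s(0, n - 1)) <;>
    by_cases hz : Odd z <;> cases A <;> cases B <;> simp [hx, hy, hz] at h2 ⊢

theorem cycleEdges_eq_map_add_one {n : ℕ} [NeZero n] (f : Fin n → V) :
    cycleEdges n f = Finset.univ.val.map fun i => s(f i, f (i + 1)) := by
  refine Multiset.map_congr rfl fun i _ => ?_
  congr 3
  simp

theorem mem_cycleEdges {n : ℕ} [NeZero n] {f : Fin n → V} {e : Sym2 V} :
    e ∈ cycleEdges n f ↔ ∃ i, s(f i, f (i + 1)) = e := by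
  rw [cycleEdges_eq_map_add_one, Multiset.mem_map]
  simp

theorem cycleEdges_add_left {n : ℕ} [NeZero n] (f : Fin n → V) (i₀ : Fin n) :
    (cycleEdges n fun i => f (i₀ + i)) = cycleEdges n f := by
  rw [cycleEdges_eq_map_add_one, cycleEdges_eq_map_add_one]
  conv_rhs => rw [← Multiset.map_univ_val_equiv (Equiv.addLeft i₀), Multiset.map_map]
  refine Multiset.map_congr rfl fun i _ => ?_
  simp [add_assoc]

theorem cycleEdges_sub_left {n : ℕ} [NeZero n] (f : Fin n → V) (i₀ : Fin n) :
    (cycleEdges n fun i => f (i₀ - i)) = cycleEdges n f := by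
  rw [cycleEdges_eq_map_add_one, cycleEdges_eq_map_add_one]
  conv_rhs => rw [← Multiset.map_univ_val_equiv (Equiv.subLeft (i₀ - 1)), Multiset.map_map]
  refine Multiset.map_congr rfl fun i _ => ?_
  have h1 : i₀ - i = i₀ - 1 - i + 1 := by abel
  have h2 : i₀ - (i + 1) = i₀ - 1 - i := by abel
  exact Sym2.eq_iff.mpr (Or.inr ⟨congrArg f h1, congrArg f h2⟩)

theorem exists_rotation {n : ℕ} [NeZero n] {f : Fin n → V} (hf : Function.Injective f)
    (i₀ : Fin n) :
    ∃ f' : Fin n → V, Function.Injective f' ∧ Finset.univ.image f' = Finset.univ.image f ∧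
      cycleEdges n f' = cycleEdges n f ∧ f' 0 = f i₀ := by
  refine ⟨fun i => f (i₀ + i), hf.comp (add_right_injective i₀), ?_,
    cycleEdges_add_left f i₀, by simp⟩
  ext v
  simp only [Finset.mem_image, Finset.mem_univ, true_and]
  exact ((Equiv.addLeft i₀).surjective.exists (p := fun j => f j = v)).symm

theorem exists_rotation_of_mem {n : ℕ} [NeZero n] {f : Fin n → V} (hf : Function.Injective f)
    {a b : V} (hab : s(a, b) ∈ cycleEdges n f) :
    ∃ f' : Fin n → V, Function.Injective f' ∧ Finset.univ.image f' = Finset.univ.image f ∧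
      cycleEdges n f' = cycleEdges n f ∧ f' 0 = a ∧ f' 1 = b := by
  obtain ⟨i, hi⟩ := mem_cycleEdges.mp hab
  rcases Sym2.eq_iff.mp hi with ⟨rfl, rfl⟩ | ⟨rfl, rfl⟩
  · refine ⟨fun j => f (i + j), hf.comp (add_right_injective i), ?_,
      cycleEdges_add_left f i, by simp, rfl⟩
    ext v
    simp only [Finset.mem_image, Finset.mem_univ, true_and]
    exact ((Equiv.addLeft i).surjective.exists (p := fun j => f j = v)).symm
  · refine ⟨fun j => f (i + 1 - j), hf.comp (sub_right_injective), ?_,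
      cycleEdges_sub_left f (i + 1), by simp, by simp⟩
    ext v
    simp only [Finset.mem_image, Finset.mem_univ, true_and]
    exact ((Equiv.subLeft (i + 1)).surjective.exists (p := fun j => f j = v)).symm

theorem mem_cycleEdges_val {n : ℕ} {e : Sym2 ℕ} (he : e ∈ cycleEdges n Fin.val) :
    (∃ j, j + 1 < n ∧ e = s(j, j + 1)) ∨ e = s(0, n - 1) := by
  obtain ⟨i, -, rfl⟩ := Multiset.mem_map.mp he
  by_cases h : i.val + 1 < n
  · exact Or.inl ⟨i, h, by simp [Nat.mod_eq_of_lt h]⟩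
  · have hi : i.val + 1 = n := by omega
    right
    simp only [hi, Nat.mod_self]
    rw [Sym2.eq_swap]
    congr 2
    omega

theorem count_cycleEdges_val_le_one {n : ℕ} (hn : 3 ≤ n) (e : Sym2 ℕ) :
    (cycleEdges n Fin.val).count e ≤ 1 := by
  refine Multiset.nodup_iff_count_le_one.mp ?_ e
  refine Multiset.Nodup.map_on ?_ Finset.univ.nodup
  intro i _ j _ hij
  have hmod : ∀ k : Fin n, (k.val + 1) % n = if k.val + 1 = n then 0 else k.val + 1 := by
    intro k
    split_ifs with h
    · rw [h, Nat.mod_self]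
    · exact Nat.mod_eq_of_lt (by omega)
  simp only [hmod, Sym2.eq_iff] at hij
  ext
  split_ifs at hij <;> omega

theorem filter_map_le {g : V → ℕ} (S : Multiset (Sym2 V)) :
    (S.map (Sym2.map g)).filter (fun e => ¬ e.IsDiag) ≤
      (S.filter fun e => ¬ e.IsDiag).map (Sym2.map g) := by
  rw [Multiset.filter_map]
  refine Multiset.map_le_map (Multiset.monotone_filter_right S fun e he => ?_)
  contrapose! he
  induction e using Sym2.ind with
  | _ x y =>
    obtain rfl : x = y := by simpa using he
    simp

/-- If the collapsed graph is spanned by the cycle `f`, based at `u`, then a rooted immersion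
of `W₄` yields a placement of `W₄` on the positions along `f` together with its loads. -/
theorem ImmersionVia.exists_loads {G : MG V} {φ : Fin 5 → V} (hφ : ImmersionVia G w4Edges φ)
    {W0 : Finset V} {w0 : V} (hφ0 : φ 0 ∉ W0) (hW : W0.card ≤ 2) (hw0 : w0 ∈ W0)
    {n : ℕ} [NeZero n] (hn : 3 ≤ n) {f : Fin n → V} (hf : Function.Injective f)
    (himg : Finset.univ.image f = (mapGraph (collapseFun W0 w0) G).verts)
    (hf0 : f 0 = φ 0) {q : Fin n} (hq : f q = w0) {r : ℕ} (hr1 : r ≠ 1) (hr2 : r ≠ n - 1)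
    {X : Multiset (Sym2 ℕ)}
    (hE : (mapGraph (collapseFun W0 w0) G).edges.map
      (Sym2.map (Function.extend f Fin.val fun _ => 0)) = 2 • cycleEdges n Fin.val + X)
    (hX : ∀ e ∈ X, (∃ j, j + 1 < n ∧ e = s(j, j + 1)) ∨ e = s(0, n - 1) ∨ e = s(0, r)) :
    ∃ p, IsPlacement n q p ∧ ∃ c h : BitVec 8,
      weight c ≤ 2 + X.count s(0, n - 1) ∧
      (0 < r → weight h ≤ 2 * (cycleEdges n Fin.val).count s(0, r) + X.count s(0, r)) ∧
      ∀ i, i + 1 < n →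
        weight (c ^^^ (if i < r then h else 0) ^^^ wheelCut (below p i)) ≤
          2 + X.count s(i, i + 1) := by
  set col := collapseFun W0 w0 with hcol
  set pos : V → ℕ := Function.extend f Fin.val fun _ => 0 with hpos
  have hpf : ∀ j, pos (f j) = j.val := fun j => hf.extend_apply _ _ j
  have hcolW : ∀ v, v ∈ W0 → col v = w0 := fun v hv => if_pos hv
  have hcolN : ∀ v, v ∉ W0 → col v = v := fun v hv => if_neg hv
  have hcolw0 : ∀ a, col (φ a) = w0 → φ a ∈ W0 := by
    intro a ha
    by_contra h
    rw [hcolN _ h] at ha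
    exact h (ha ▸ hw0)
  have hsurj : ∀ a, ∃ j, f j = col (φ a) := by
    intro a
    have : col (φ a) ∈ Finset.univ.image f := by
      rw [himg]
      exact Finset.mem_image_of_mem _ (hφ.2.1 a)
    simpa using this
  have hp0 : pos (col (φ 0)) = 0 := by
    rw [hcolN _ hφ0, ← hf0, hpf]
    simp
  have hplace : IsPlacement n q fun a => pos (col (φ a)) := by
    refine ⟨hp0, fun k => ?_, fun k => ?_, fun j hj => ?_, ?_⟩
    · obtain ⟨j, hj⟩ := hsurj k.succ
      simp only [← hj, hpf]
      by_contra! h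
      obtain rfl : j = 0 := Fin.ext (by simpa using h)
      by_cases hk : φ k.succ ∈ W0
      · rw [hcolW _ hk] at hj
        exact hφ0 (hf0 ▸ hj ▸ hw0)
      · rw [hcolN _ hk, hf0] at hj
        exact Fin.succ_ne_zero k (hφ.1 hj).symm
    · obtain ⟨j, hj⟩ := hsurj k.succ
      simp only [← hj, hpf]
      exact j.isLt
    · rw [Finset.card_le_one]
      intro a ha b hb
      simp only [Finset.mem_filter, Finset.mem_univ, true_and] at ha hb
      have aux : ∀ k : Fin 4, pos (col (φ k.succ)) = j → φ k.succ ∉ W0 := by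
        intro k hk hmem
        rw [hcolW _ hmem, ← hq, hpf] at hk
        exact hj hk.symm
      obtain ⟨i, hi⟩ := hsurj a.succ
      obtain ⟨i', hi'⟩ := hsurj b.succ
      have hii : i = i' := by
        ext
        rw [← hpf, ← hpf, hi, hi', ha, hb]
      rw [hcolN _ (aux a ha)] at hi
      rw [hcolN _ (aux b hb)] at hi'
      exact Fin.succ_injective _ (hφ.1 (by rw [← hi, ← hi', hii]))
    · refine (Finset.card_le_card_of_injOn (fun k : Fin 4 => φ k.succ) ?_ ?_).trans hW
      · intro k hk
        simp only [Finset.coe_filter, Finset.mem_univ, true_and, Set.mem_ofPred_eq] at hk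
        obtain ⟨j, hj⟩ := hsurj k.succ
        rw [← hj, hpf] at hk
        obtain rfl : j = q := Fin.ext hk
        exact hcolw0 _ (by rw [← hj, hq])
      · exact fun a _ b _ h => Fin.succ_injective _ (hφ.1 h)
  obtain ⟨w, hw, hwle⟩ := hφ.exists_walks
  refine ⟨_, hplace, ?_⟩
  obtain ⟨c, h, h1, h2, h3⟩ := PaperW4.exists_loads hn hr1 hr2
    (fun a => pos (col (φ a))) hp0 (fun k => walkEdges ((w k).map (pos ∘ col)))
    (by
      intro k χ
      rcases hw k with hk | hk
      · exact odd_countP_separates χ _ _ (hk.map (pos ∘ col))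
      · exact (odd_countP_separates χ _ _ (hk.map (pos ∘ col))).trans ne_comm)
    (2 • cycleEdges n Fin.val + X)
    (by
      have hsum : ∑ k, walkEdges ((w k).map (pos ∘ col)) =
          ((∑ k, walkEdges (w k)).map (Sym2.map col)).map (Sym2.map pos) := by
        rw [Multiset.map_map, ← Sym2.map_comp, ← Multiset.coe_mapAddMonoidHom, map_sum]
        exact Finset.sum_congr rfl fun k _ => walkEdges_map _ _
      rw [hsum, ← hE]
      refine (filter_map_le _).trans (Multiset.map_le_map ?_)
      exact Multiset.filter_le_filter _ (Multiset.map_le_map hwle))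
    (by
      intro e he
      rcases Multiset.mem_add.mp he with he | he
      · rcases mem_cycleEdges_val (Multiset.mem_of_mem_nsmul he) with h | h
        · exact Or.inl h
        · exact Or.inr (Or.inl h)
      · exact hX e he)
  simp only [Multiset.count_add, Multiset.count_nsmul] at h1 h2 h3
  refine ⟨c, h, ?_, h2, fun i hi => ?_⟩
  · have := count_cycleEdges_val_le_one hn s(0, n - 1)
    omega
  · have := count_cycleEdges_val_le_one hn s(i, i + 1)
    have := h3 i hi
    omega

theorem map_extend_cycleEdges {n : ℕ} {f : Fin n → V} (hf : Function.Injective f) :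
    (cycleEdges n f).map (Sym2.map (Function.extend f Fin.val fun _ => 0)) =
      cycleEdges n Fin.val := by
  rw [cycleEdges, cycleEdges, Multiset.map_map]
  refine Multiset.map_congr rfl fun i _ => ?_
  simp [hf.extend_apply]

/-- Let `G` be a rooted graph with root `u` of type 2.  Then `G`
has no rooted immersion of `W₄`. -/
theorem statement_14 {V : Type} (G : MG V) (u : V)
    (hu : u ∈ G.verts) (hconn : Connected G)
    (h2 : TypeTwo G u) :
    ¬ HasRootedW4Immersion G u := by
  rintro ⟨φ, rfl, hφ⟩
  obtain ⟨W0, -, huW, -, hW, w0, hw0, n, hn, f, hf, himg, ⟨i, hi⟩, ⟨j, hj⟩, hcases⟩ := h2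
  have : NeZero n := ⟨by omega⟩
  have hne : φ 0 ≠ w0 := fun h => huW (h ▸ hw0)
  have h1val : (1 : Fin n).val = 1 := by
    rw [Fin.val_one', Nat.mod_eq_of_lt (by omega)]
  rcases hcases with ⟨hnot, hE⟩ | ⟨v, huv, hvw, hE⟩ | ⟨hmem, hE⟩
  · obtain ⟨f', hf', himg', hcyc, h0⟩ := exists_rotation hf i
    rw [hi] at h0
    rw [← himg'] at himg
    rw [← hcyc] at hnot hE
    obtain ⟨q, hq⟩ : ∃ q, f' q = w0 := by
      have : w0 ∈ Finset.univ.image f' := by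
        rw [himg', ← hj]
        exact Finset.mem_image_of_mem f (Finset.mem_univ j)
      simpa using this
    have hq0 : q.val ≠ 0 := by
      intro h
      obtain rfl : q = 0 := Fin.ext (by simpa using h)
      exact hne (h0.symm.trans hq)
    have hq1 : q.val ≠ 1 := by
      intro h
      obtain rfl : q = 1 := Fin.ext (by rw [h, h1val])
      exact hnot (mem_cycleEdges.mpr ⟨0, by rw [h0, zero_add, hq]⟩)
    have hqn : q.val ≠ n - 1 := by
      intro h
      have : q + 1 = 0 := by
        ext
        rw [Fin.val_add, h1val, h, Nat.sub_add_cancel (by omega), Nat.mod_self]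
        simp
      exact hnot (mem_cycleEdges.mpr ⟨q, by rw [this, h0, hq, Sym2.eq_swap]⟩)
    have hlt := q.isLt
    have hE' := congrArg
      (Multiset.map (Sym2.map (Function.extend f' Fin.val fun _ => 0))) hE
    rw [Multiset.map_add, Multiset.map_nsmul, map_extend_cycleEdges hf', ← h0, ← hq,
      Multiset.map_singleton, Sym2.map_mk, hf'.extend_apply, hf'.extend_apply,
      Fin.val_zero] at hE'
    obtain ⟨p, hp, c, h, hc, hh, hload⟩ := hφ.exists_loads huW hW hw0 hn hf' himg h0 hq
      hq1 hqn (hq ▸ hE') (by simp)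
    have hcyc0 : (cycleEdges n Fin.val).count s(0, q.val) = 0 := by
      rw [Multiset.count_eq_zero]
      intro hmem
      rcases mem_cycleEdges_val hmem with ⟨k, hk, he⟩ | he
      · simp at he
        omega
      · simp at he
        omega
    refine hp.false_of_chord (by omega) (by omega) c h ?_ ?_ fun k hk => ?_
    · rw [Multiset.count_singleton, if_neg (by simp; omega)] at hc
      exact hc
    · simpa [hcyc0] using hh (by omega)
    · have := hload k hk
      have hk' : s(k, k + 1) ≠ s(0, q.val) := by simp; omega
      rw [Multiset.count_singleton, if_neg hk'] at this
      exact this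
  · obtain ⟨f', hf', himg', hcyc, h0, h1⟩ := exists_rotation_of_mem hf huv
    rw [← himg'] at himg
    rw [← hcyc] at hvw hE
    have h2val : (1 + 1 : Fin n).val = 2 := by
      rw [Fin.val_add, h1val, Nat.mod_eq_of_lt (by omega)]
    have hq : f' (1 + 1) = w0 := by
      obtain ⟨k, hk⟩ := mem_cycleEdges.mp hvw
      rcases Sym2.eq_iff.mp hk with ⟨hk1, hk2⟩ | ⟨hk1, hk2⟩
      · obtain rfl : k = 1 := hf' (hk1.trans h1.symm)
        exact hk2
      · obtain rfl : k = 0 := by simpa using hf' (hk2.trans h1.symm)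
        exact absurd (h0.symm.trans hk1) hne
    have hE' := congrArg
      (Multiset.map (Sym2.map (Function.extend f' Fin.val fun _ => 0))) hE
    rw [Multiset.map_add, Multiset.map_nsmul, map_extend_cycleEdges hf', ← h0, ← h1, ← hq,
      Multiset.insert_eq_cons, Multiset.map_cons,
      Multiset.map_singleton, Sym2.map_mk, Sym2.map_mk, hf'.extend_apply, hf'.extend_apply,
      hf'.extend_apply, h1val, h2val, Fin.val_zero] at hE'
    obtain ⟨p, hp, c, h, hc, -, hload⟩ := hφ.exists_loads huW hW hw0 hn hf' himg h0 hq
      (r := 0) (by omega) (by omega) (hq ▸ hE') (by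
        intro e he
        rcases (by simpa using he : e = s(0, 1) ∨ e = s(1, 2)) with rfl | rfl
        · exact Or.inl ⟨0, by omega, rfl⟩
        · exact Or.inl ⟨1, by omega, rfl⟩)
    rw [h2val] at hp
    have hcount : ∀ a b : ℕ, (s(0, 1) ::ₘ {s(1, 2)} : Multiset (Sym2 ℕ)).count s(a, b) =
        (if s(a, b) = s(1, 2) then 1 else 0) + if s(a, b) = s(0, 1) then 1 else 0 := by
      intro a b
      rw [Multiset.count_cons, Multiset.count_singleton]
    simp only [hcount, Nat.not_lt_zero, if_false, BitVec.ofNat_eq_ofNat,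
      BitVec.xor_zero] at hc hload
    refine hp.false_of_path hn (by omega) le_rfl c ?_ (fun k hk => ?_) fun k hk hkn => ?_
    · rw [if_neg (by simp), if_neg (by simp; omega)] at hc
      exact hc
    · refine (hload k hk).trans ?_
      split_ifs with e1 e2
      · simp at e1 e2
        omega
      all_goals omega
    · have := hload k hkn
      rw [if_neg (by simp; omega), if_neg (by simp; omega)] at this
      exact this
  · obtain ⟨f', hf', himg', hcyc, h0, hq⟩ := exists_rotation_of_mem hf hmem
    rw [← himg'] at himg
    rw [← hcyc] at hE
    have hE' := congrArg
      (Multiset.map (Sym2.map (Function.extend f' Fin.val fun _ => 0))) hE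
    rw [Multiset.map_add, Multiset.map_nsmul, map_extend_cycleEdges hf', ← h0, ← hq,
      Multiset.map_singleton, Sym2.map_mk, hf'.extend_apply, hf'.extend_apply,
      h1val, Fin.val_zero] at hE'
    obtain ⟨p, hp, c, h, hc, -, hload⟩ := hφ.exists_loads huW hW hw0 hn hf' himg h0 hq
      (r := 0) (by omega) (by omega) (hq ▸ hE') (by
        intro e he
        obtain rfl : e = s(0, 1) := by simpa using he
        exact Or.inl ⟨0, by omega, rfl⟩)
    rw [h1val] at hp
    simp only [Multiset.count_singleton, Nat.not_lt_zero, if_false, BitVec.ofNat_eq_ofNat,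
      BitVec.xor_zero] at hc hload
    refine hp.false_of_path hn le_rfl (by omega) c ?_ (fun k hk => ?_) fun k hk hkn => ?_
    · rw [if_neg (by simp; omega)] at hc
      exact hc
    · refine (hload k hk).trans ?_
      split_ifs <;> omega
    · have := hload k hkn
      rw [if_neg (by simp; omega)] at this
      exact this

end PaperW4
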